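/- Let n and s be integers with 3 ≤ n ≤ 127 and 9 ≤ s ≤ 103. If g₁(x) = g₁(x,n,s) is the product of a polynomial of degree 1 and an irreducible polynomial in ℚ[x], then g₁(x) is irreducible over ℚ. (Equivalently: for such n and s, g₁(x,n,s) admits no factorization into a degree-1 polynomial times an irreducible polynomial.) -/

import Mathlib

open Polynomial Finset

/-- g₁(x,n,s) = n!·∑_{j=0}^{n} C(n+s−j, n−j)·x^j/j!, as a polynomial over ℚ. -/
noncomputable def g1 (n s : ℕ) : ℚ[X] :=
  (n.factorial : ℚ[X]) *
    ∑ j ∈ Finset.range (n + 1),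
      Polynomial.C (((n + s - j).choose (n - j) : ℚ) / (j.factorial : ℚ)) * Polynomial.X ^ j

/-- The polynomial `g1 n s` over `ℤ`, defined through its three-term recurrence in `n`. -/
noncomputable def g1Int (s : ℕ) : ℕ → ℤ[X]
  | 0 => 1
  | 1 => X + C (s + 1 : ℤ)
  | m + 2 => (X + C (m + s + 2 : ℤ)) * g1Int s (m + 1) - C (m + 1 : ℤ) * (X * g1Int s m)

lemma g1Int_succ (s m : ℕ) :
    g1Int s (m + 1) = (X + C (m + s + 1 : ℤ)) * g1Int s m - C (m : ℤ) * (X * g1Int s (m - 1)) := by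
  cases m with
  | zero => simp [g1Int]
  | succ m =>
    rw [g1Int]
    push_cast
    simp only [map_add, map_natCast, map_one, map_ofNat]
    ring

lemma choose_add_succ_mul (i s : ℕ) :
    (i + 1) * (i + 1 + s).choose s = (i + 1 + s) * (i + s).choose s := by
  have h := Nat.choose_mul_succ_eq (i + s) s
  rw [show i + s + 1 - s = i + 1 by omega, show i + s + 1 = i + 1 + s by ring] at h
  linarith

lemma coeff_g1Int_mul_factorial (s m j : ℕ) :
    (g1Int s m).coeff j * (j.factorial : ℤ) =
      m.factorial * (if j ≤ m then ((m - j + s).choose s : ℤ) else 0) := by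
  induction m using Nat.twoStepInduction generalizing j with
  | zero =>
    rcases j with _ | j
    · simp [g1Int]
    · simp [g1Int, coeff_one]
  | one =>
    rcases j with _ | _ | j
    · have := choose_add_succ_mul 0 s
      simp only [zero_add, Nat.choose_self, mul_one, one_mul] at this
      simp [g1Int, this, coeff_X, coeff_one]
      ring
    · simp [g1Int, coeff_X, coeff_one]
    · simp [g1Int, coeff_X, coeff_one]
  | more m ih₀ ih₁ =>
    rcases j with _ | j
    · have h₁ := ih₁ 0
      have h := choose_add_succ_mul (m + 1) s
      simp only [Nat.factorial_zero, Nat.cast_one, mul_one, zero_le, if_true, Nat.sub_zero] at h₁ ⊢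
      rw [g1Int, Nat.factorial_succ (m + 1)]
      simp only [coeff_sub, add_mul, coeff_add, mul_coeff_zero, coeff_X_zero, coeff_C_zero, h₁]
      zify at h
      push_cast
      linear_combination -((m + 1).factorial : ℤ) * h
    · have h₀ := ih₀ j
      have h₁ := ih₁ j
      have h₂ := ih₁ (j + 1)
      rw [g1Int]
      simp only [coeff_sub, add_mul, coeff_add, coeff_X_mul, coeff_C_mul]
      rw [Nat.factorial_succ (m + 1)]
      rw [Nat.factorial_succ j] at h₂ ⊢
      rw [Nat.factorial_succ m] at h₁ h₂ ⊢
      push_cast at h₀ h₁ h₂ ⊢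
      rcases lt_trichotomy j (m + 1) with hj | rfl | hj
      · obtain ⟨i, rfl⟩ := Nat.exists_eq_add_of_le (Nat.le_of_lt_succ hj)
        have h := choose_add_succ_mul i s
        rw [if_pos (by omega)] at h₀ h₁ h₂ ⊢
        rw [show j + i - j + s = i + s by omega] at h₀
        rw [show j + i + 1 - j + s = i + 1 + s by omega] at h₁
        rw [show j + i - j + s = i + s by omega] at h₂
        rw [show j + i + 1 - j + s = i + 1 + s by omega]
        zify at h
        push_cast at h₀ h₁ h₂ ⊢
        linear_combination (j + 1 : ℤ) * h₁ + (j + i + s + 2 : ℤ) * h₂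
          - (j + i + 1 : ℤ) * (j + 1) * h₀ - (j + i + 1 : ℤ) * ((j + i).factorial : ℤ) * h
      · rw [if_neg (by omega)] at h₀ h₂
        rw [if_pos (by omega)] at h₁ ⊢
        rw [show m + 1 - (m + 1) + s = s by omega] at h₁
        rw [show m + 1 - (m + 1) + s = s by omega]
        push_cast at h₀ h₁ h₂ ⊢
        linear_combination (m + 2 : ℤ) * h₁ + (m + s + 2 : ℤ) * h₂ - (m + 1 : ℤ) * (m + 2) * h₀
      · rw [if_neg (by omega)] at h₀ h₁ h₂ ⊢
        linear_combination (j + 1 : ℤ) * h₁ + (m + s + 2 : ℤ) * h₂ - (m + 1 : ℤ) * (j + 1) * h₀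

lemma natDegree_g1Int_le (s m : ℕ) : (g1Int s m).natDegree ≤ m := by
  rw [natDegree_le_iff_coeff_eq_zero]
  intro j hj
  have h := coeff_g1Int_mul_factorial s m j
  rw [if_neg (by omega), mul_zero] at h
  simpa [Nat.factorial_ne_zero] using h

lemma coeff_g1Int_self (s m : ℕ) : (g1Int s m).coeff m = 1 := by
  have h := coeff_g1Int_mul_factorial s m m
  simpa [Nat.factorial_ne_zero] using h

lemma monic_g1Int (s m : ℕ) : (g1Int s m).Monic :=
  monic_of_natDegree_le_of_coeff_eq_one m (natDegree_g1Int_le s m) (coeff_g1Int_self s m)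

lemma natDegree_g1Int (s m : ℕ) : (g1Int s m).natDegree = m :=
  natDegree_eq_of_le_of_coeff_ne_zero (natDegree_g1Int_le s m) (by simp [coeff_g1Int_self])

lemma coeff_g1Int_of_le {s m j : ℕ} (hj : j ≤ m) :
    (g1Int s m).coeff j = m.descFactorial (m - j) * (m - j + s).choose s := by
  have h := coeff_g1Int_mul_factorial s m j
  have hf := Nat.factorial_mul_descFactorial (n := m) (k := m - j) (by omega)
  rw [show m - (m - j) = j by omega] at hf
  have h0 : (j.factorial : ℤ) ≠ 0 := by exact_mod_cast Nat.factorial_ne_zero j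
  rw [if_pos hj, ← hf] at h
  apply mul_right_cancel₀ h0
  rw [h]
  push_cast
  ring

lemma map_g1Int (n s : ℕ) : (g1Int s n).map (Int.castRingHom ℚ) = g1 n s := by
  ext j
  have h := congrArg (Int.cast : ℤ → ℚ) (coeff_g1Int_mul_factorial s n j)
  have h0 : (j.factorial : ℚ) ≠ 0 := by exact_mod_cast Nat.factorial_ne_zero j
  rw [coeff_map, g1, ← C_eq_natCast, coeff_C_mul, finsetSum_coeff]
  simp only [coeff_C_mul_X_pow]
  rw [Finset.sum_ite_eq, eq_intCast]
  push_cast at h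
  rw [eq_div_iff h0 |>.mpr h]
  simp only [Finset.mem_range, Nat.lt_succ_iff]
  split_ifs with hj
  · rw [show n + s - j = n - j + s by omega, Nat.choose_symm_add]
    ring
  · simp

/-! ### Real zeros -/

/-- The real-valued polynomial function attached to `g1Int`. -/
noncomputable def g1Real (s m : ℕ) : ℝ[X] := (g1Int s m).map (Int.castRingHom ℝ)

lemma eval_g1Real_succ (s m : ℕ) (x : ℝ) :
    (g1Real s (m + 1)).eval x =
      (x + m + s + 1) * (g1Real s m).eval x - m * x * (g1Real s (m - 1)).eval x := by
  rw [g1Real, g1Int_succ]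
  simp [g1Real]
  ring

lemma derivative_g1Int_succ (s m : ℕ) :
    derivative (g1Int s (m + 1)) = C (m + 1 : ℤ) * g1Int s m := by
  induction m using Nat.strong_induction_on with
  | _ m ih =>
    rcases m with _ | _ | m
    · simp [g1Int]
    · simp [g1Int]
      ring
    · rw [g1Int_succ s (m + 2)]
      have h₁ := ih (m + 1) (by omega)
      have h₀ := ih m (by omega)
      have h := g1Int_succ s (m + 1)
      simp only [Nat.add_sub_cancel, show m + 2 - 1 = m + 1 by omega] at h ⊢
      simp only [derivative_sub, derivative_mul, derivative_add, derivative_X, derivative_C,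
        h₁, h₀, show m + 2 = m + 1 + 1 from rfl]
      push_cast at h ⊢
      simp only [map_add, map_one, map_natCast] at h ⊢
      linear_combination (-(m : ℤ[X]) - 2) * h

lemma hasDerivAt_g1Real_succ (s m : ℕ) (x : ℝ) :
    HasDerivAt (fun y => (g1Real s (m + 1)).eval y) ((m + 1) * (g1Real s m).eval x) x := by
  have h := (g1Real s (m + 1)).hasDerivAt x
  rw [g1Real, derivative_map, derivative_g1Int_succ] at h
  simpa [g1Real] using h

lemma monic_g1Real (s m : ℕ) : (g1Real s m).Monic := (monic_g1Int s m).map _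

lemma natDegree_g1Real (s m : ℕ) : (g1Real s m).natDegree = m := by
  rw [g1Real, (monic_g1Int s m).natDegree_map, natDegree_g1Int]

lemma g1Real_eval_pos_of_nonneg (s m : ℕ) {x : ℝ} (hx : 0 ≤ x) : 0 < (g1Real s m).eval x := by
  rw [eval_eq_sum_range' ((natDegree_g1Real s m).trans_lt m.lt_succ_self),
    Finset.sum_range_succ']
  have hc : ∀ j ≤ m, 0 < (g1Real s m).coeff j := by
    intro j hj
    rw [g1Real, coeff_map, coeff_g1Int_of_le hj]
    have h₁ : 0 < m.descFactorial (m - j) := Nat.pos_of_ne_zero (by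
      rw [Ne, Nat.descFactorial_eq_zero_iff_lt]; omega)
    have h₂ : 0 < (m - j + s).choose s := Nat.choose_pos (by omega)
    simp only [eq_intCast]
    exact_mod_cast Nat.mul_pos h₁ h₂
  refine add_pos_of_nonneg_of_pos (Finset.sum_nonneg fun j hj => ?_)
    (by simpa using hc 0 (by omega))
  exact mul_nonneg (hc _ (by simp at hj; omega)).le (by positivity)

lemma tendsto_g1Real_atTop (s m : ℕ) :
    Filter.Tendsto (fun x => (g1Real s (m + 1)).eval x) Filter.atTop Filter.atTop := by
  apply tendsto_atTop_of_leadingCoeff_nonneg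
  · rw [← natDegree_pos_iff_degree_pos, natDegree_g1Real]
    omega
  · rw [monic_g1Real]
    exact zero_le_one

lemma tendsto_g1Real_atBot (s : ℕ) {m : ℕ} (hm : Odd m) :
    Filter.Tendsto (fun x => (g1Real s (m + 1)).eval x) Filter.atBot Filter.atTop := by
  have h : Filter.Tendsto (fun x => ((g1Real s (m + 1)).comp (-X)).eval x)
      Filter.atTop Filter.atTop := by
    apply tendsto_atTop_of_leadingCoeff_nonneg
    · rw [← natDegree_pos_iff_degree_pos, natDegree_comp, natDegree_g1Real, natDegree_neg,
        natDegree_X]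
      omega
    · rw [leadingCoeff_comp (by simp), monic_g1Real, natDegree_g1Real, leadingCoeff_neg,
        leadingCoeff_X, hm.add_one.neg_one_pow]
      simp
  simpa [Function.comp_def] using h.comp Filter.tendsto_neg_atBot_atTop

lemma g1Real_eval_pos_of_even (s : ℕ) {m : ℕ} (hm : Even m) (x : ℝ) :
    0 < (g1Real s m).eval x := by
  induction m using Nat.twoStepInduction generalizing x with
  | zero => simp [g1Real, g1Int]
  | one => exact absurd hm (by decide)
  | more m ih _ =>
    have hm' : Even m := by simpa [Nat.even_add] using hm
    obtain ⟨r, hr⟩ := (g1Real s (m + 2)).continuous.exists_forall_le (by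
      rw [cocompact_eq_atBot_atTop]
      exact (tendsto_g1Real_atBot s hm'.add_one).sup (tendsto_g1Real_atTop s (m + 1)))
    refine lt_of_lt_of_le ?_ (hr x)
    have hd := IsLocalMin.hasDerivAt_eq_zero (Filter.Eventually.of_forall hr)
      (hasDerivAt_g1Real_succ s (m + 1) r)
    have h₀ : (g1Real s (m + 1)).eval r = 0 :=
      (mul_eq_zero.mp hd).resolve_left (by positivity)
    have hneg : r < 0 := by
      by_contra! h
      exact (g1Real_eval_pos_of_nonneg s (m + 1) h).ne' h₀
    have h := eval_g1Real_succ s (m + 1) r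
    rw [h₀] at h
    rw [h]
    have := mul_pos (mul_pos (show (0 : ℝ) < m + 1 by positivity) (neg_pos.mpr hneg)) (ih hm' r)
    push_cast
    linarith

lemma strictMono_g1Real_of_odd (s : ℕ) {m : ℕ} (hm : Odd m) :
    StrictMono fun x => (g1Real s m).eval x := by
  obtain ⟨k, rfl⟩ := hm
  exact strictMono_of_hasDerivAt_pos (hasDerivAt_g1Real_succ s (2 * k)) fun x =>
    mul_pos (by positivity) (g1Real_eval_pos_of_even s (even_two_mul k) x)

lemma eval_intCast_g1Real (s m : ℕ) (r : ℤ) :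
    (g1Real s m).eval (r : ℝ) = ((g1Int s m).eval r : ℤ) := by
  rw [g1Real, eval_intCast_map, eq_intCast, Int.cast_id]

lemma eval_g1Int_ne_zero_of_even (s : ℕ) {m : ℕ} (hm : Even m) (r : ℤ) :
    (g1Int s m).eval r ≠ 0 := by
  have h := g1Real_eval_pos_of_even s hm (r : ℝ)
  rw [eval_intCast_g1Real] at h
  exact_mod_cast h.ne'

lemma strictMono_eval_g1Int_of_odd (s : ℕ) {m : ℕ} (hm : Odd m) :
    StrictMono fun r : ℤ => (g1Int s m).eval r := by
  intro a b hab
  have h := strictMono_g1Real_of_odd s hm (Int.cast_lt (R := ℝ).mpr hab)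
  simp only [eval_intCast_g1Real] at h
  exact_mod_cast h

/-! ### Divisibility of the constant term -/

lemma eval_g1Int_eq_sum (s m : ℕ) (r : ℤ) :
    (g1Int s m).eval r = ∑ j ∈ Finset.range (m + 1), (g1Int s m).coeff j * r ^ j :=
  eval_eq_sum_range' (Nat.lt_succ_of_le (natDegree_g1Int_le s m)) r

lemma prime_dvd_of_eval_g1Int_eq_zero {p n s : ℕ} (hp : p.Prime) (hpn : p ∣ n) {r : ℤ}
    (hr : (g1Int s n).eval r = 0) : (p : ℤ) ∣ r := by
  have h := eval_g1Int_eq_sum s n r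
  rw [hr, Finset.sum_range_succ, coeff_g1Int_self, one_mul] at h
  refine (Nat.prime_iff_prime_int.mp hp).dvd_of_dvd_pow (n := n) ?_
  refine (dvd_add_right (Finset.dvd_sum fun j hj => ?_)).mp (h ▸ dvd_zero (p : ℤ))
  have hj : j < n := Finset.mem_range.mp hj
  rw [coeff_g1Int_of_le hj.le]
  refine dvd_mul_of_dvd_left (dvd_mul_of_dvd_left ?_ _) _
  obtain ⟨n, rfl⟩ := Nat.exists_eq_succ_of_ne_zero (by omega : n ≠ 0)
  rw [show n.succ - j = n - j + 1 by omega, Nat.succ_descFactorial_succ]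
  exact_mod_cast hpn.mul_right _

lemma pow_dvd_of_mul_factorial_eq {p a j : ℕ} (hp : p.Prime) (hj : j ≠ 0) {t : ℤ}
    (h : (p : ℤ) ^ (a + j) ∣ t * j.factorial) : (p : ℤ) ^ (a + 1) ∣ t := by
  have := Fact.mk hp
  obtain ⟨u, hu⟩ := pow_padicValNat_dvd (p := p) (n := j.factorial)
  have hlt := padicValNat_factorial_lt_of_ne_zero (p := p) hj
  have hpu : ¬ p ∣ u := by
    rintro ⟨w, rfl⟩
    refine pow_succ_padicValNat_not_dvd (p := p) (Nat.factorial_ne_zero j) ⟨w, ?_⟩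
    conv_lhs => rw [hu]
    ring
  have hp0 : (p : ℤ) ^ padicValNat p j.factorial ≠ 0 :=
    pow_ne_zero _ (by exact_mod_cast hp.ne_zero)
  have h' : (p : ℤ) ^ padicValNat p j.factorial * (p : ℤ) ^ (a + 1) ∣
      (p : ℤ) ^ padicValNat p j.factorial * (t * u) := by
    rw [← pow_add]
    refine (pow_dvd_pow _ (by omega)).trans (h.trans (dvd_of_eq ?_))
    have hu' : (j.factorial : ℤ) = (p : ℤ) ^ padicValNat p j.factorial * u := by
      exact_mod_cast hu
    linear_combination t * hu'
  refine IsCoprime.dvd_of_dvd_mul_right ?_ ((mul_dvd_mul_iff_left hp0).mp h')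
  exact IsCoprime.pow_left
    (Nat.isCoprime_iff_coprime.mpr ((Nat.Prime.coprime_iff_not_dvd hp).mpr hpu))

lemma prime_dvd_choose_of_eval_g1Int_eq_zero {p n s : ℕ} (hp : p.Prime) (hpn : p ∣ n) {r : ℤ}
    (hr : (g1Int s n).eval r = 0) : p ∣ (n + s).choose s := by
  have := Fact.mk hp
  have hpr := prime_dvd_of_eval_g1Int_eq_zero hp hpn hr
  set a := padicValNat p n.factorial with ha
  have hdvd : (p : ℤ) ^ a ∣ n.factorial := by exact_mod_cast pow_padicValNat_dvd
  have h := eval_g1Int_eq_sum s n r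
  rw [hr, Finset.sum_range_succ'] at h
  have h0 : (p : ℤ) ^ (a + 1) ∣ (g1Int s n).coeff 0 * r ^ 0 := by
    refine (dvd_add_right (Finset.dvd_sum fun j _ => ?_)).mp (h ▸ dvd_zero _)
    refine pow_dvd_of_mul_factorial_eq hp (Nat.succ_ne_zero j) ?_
    rw [mul_right_comm, coeff_g1Int_mul_factorial, pow_add]
    exact mul_dvd_mul (hdvd.mul_right _) (pow_dvd_pow_of_dvd hpr _)
  have hc := coeff_g1Int_mul_factorial s n 0
  simp only [Nat.factorial_zero, Nat.cast_one, mul_one, zero_le, if_true, Nat.sub_zero] at hc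
  rw [pow_zero, mul_one, hc] at h0
  have h1 : p ^ (a + 1) ∣ n.factorial * (n + s).choose s := by exact_mod_cast h0
  by_contra hnd
  exact pow_succ_padicValNat_not_dvd (Nat.factorial_ne_zero n)
    (((Nat.Prime.coprime_iff_not_dvd hp).mpr hnd).pow_left _ |>.dvd_of_dvd_mul_right h1)

lemma dvd_pow_of_forall_prime_dvd {n c k : ℕ} (hn : n ≠ 0) (hk : n < 2 ^ k)
    (h : ∀ p, p.Prime → p ∣ n → p ∣ c) : n ∣ c ^ k := by
  rcases eq_or_ne c 0 with rfl | hc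
  · rw [zero_pow]
    · exact dvd_zero n
    · rintro rfl
      omega
  rw [← Nat.factorization_le_iff_dvd hn (pow_ne_zero _ hc)]
  intro p
  rw [Nat.factorization_pow, Finsupp.smul_apply, smul_eq_mul]
  by_cases hp : p.Prime ∧ p ∣ n
  · have h₁ : 1 ≤ c.factorization p := (hp.1.dvd_iff_one_le_factorization hc).mp (h p hp.1 hp.2)
    have h₂ : n.factorization p ≤ k := by
      have h₃ := Nat.le_of_dvd (Nat.pos_of_ne_zero hn) (Nat.ordProj_dvd n p)
      have h₄ := Nat.pow_le_pow_left hp.1.two_le (n.factorization p)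
      exact ((Nat.pow_lt_pow_iff_right one_lt_two).mp (by omega)).le
    nlinarith
  · have : n.factorization p = 0 := by
      rw [Nat.factorization_eq_zero_iff]
      tauto
    omega

/-! ### The finite computation -/

/-- Runs `n` steps of the recurrence for the value of `g1Int s` at `-k`, where `k = s + 1 + d`,
from index `m` on. An integer is represented as a difference `u - v` of natural numbers. -/
def recurrencePair (d k : ℕ) : (n m u₀ v₀ u₁ v₁ : ℕ) → ℕ × ℕ
  | 0, _, _, _, u₁, v₁ => (u₁, v₁)
  | n + 1, m, u₀, v₀, u₁, v₁ => recurrencePair d k n m.succ u₁ v₁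
      (((m.mul u₁).add (d.mul v₁)).add ((m.mul k).mul u₀))
      (((m.mul v₁).add (d.mul u₁)).add ((m.mul k).mul v₀))

/-- The value of `g1Int s n` at `-(s + 1 + d)`, as a difference of natural numbers. -/
def valuePair (n s d : ℕ) : ℕ × ℕ := recurrencePair d (s + 1 + d) n 0 0 0 1 0

/-- `g1Int s n` is positive at `-(s + 1 + d)` and negative at `-(s + 2 + d)` for some `d` close
to `n / 3`. -/
def signChange (n s : ℕ) : Bool :=
  [1, 2, 3, 0].any fun i =>
    let p := valuePair n s (n / 3 - i)
    let q := valuePair n s (n / 3 - i + 1)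
    Nat.blt p.2 p.1 && Nat.blt q.1 q.2

/-- For `f` consecutive values of `s`, starting with `c = (n + s).choose s`, checks that some prime
factor of `n` does not divide `(n + s).choose s` or that `signChange n s` holds; values `s < 9`
are skipped. -/
def checkFrom (n : ℕ) : (f s c : ℕ) → Bool
  | 0, _, _ => true
  | f + 1, s, c => (Nat.blt s 9 || !((c % n) ^ 7 % n == 0) || signChange n s) &&
      checkFrom n f (s + 1) (c * (n + s + 1) / (s + 1))

lemma recurrencePair_spec (s d n m u₀ v₀ u₁ v₁ : ℕ)
    (h₀ : (m : ℤ) * (u₀ - v₀) = m * (g1Int s (m - 1)).eval (-(s + 1 + d : ℕ) : ℤ))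
    (h₁ : (u₁ - v₁ : ℤ) = (g1Int s m).eval (-(s + 1 + d : ℕ) : ℤ)) :
    ((recurrencePair d (s + 1 + d) n m u₀ v₀ u₁ v₁).1 -
      (recurrencePair d (s + 1 + d) n m u₀ v₀ u₁ v₁).2 : ℤ) =
      (g1Int s (m + n)).eval (-(s + 1 + d : ℕ) : ℤ) := by
  induction n generalizing m u₀ v₀ u₁ v₁ with
  | zero => exact h₁
  | succ n ih =>
    rw [recurrencePair, show m + (n + 1) = m.succ + n by omega]
    apply ih
    · rw [h₁]
      rfl
    · rw [Nat.succ_eq_add_one, g1Int_succ]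
      simp only [Nat.add_eq, Nat.mul_eq, eval_sub, eval_mul, eval_add, eval_X, eval_C]
      push_cast at h₀ h₁ ⊢
      linear_combination (m - d : ℤ) * h₁ + (s + 1 + d : ℤ) * h₀

lemma valuePair_spec (n s d : ℕ) :
    ((valuePair n s d).1 - (valuePair n s d).2 : ℤ) =
      (g1Int s n).eval (-(s + 1 + d : ℕ) : ℤ) := by
  rw [valuePair, recurrencePair_spec, zero_add] <;> simp [g1Int]

lemma eval_g1Int_ne_zero_of_signChange {n s : ℕ} (hn : Odd n) (h : signChange n s = true) (r : ℤ) :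
    (g1Int s n).eval r ≠ 0 := by
  intro hr
  obtain ⟨i, -, hi⟩ := List.any_eq_true.mp h
  simp only [Bool.and_eq_true, Nat.blt_eq] at hi
  have hp := valuePair_spec n s (n / 3 - i)
  have hq := valuePair_spec n s (n / 3 - i + 1)
  have hmono := strictMono_eval_g1Int_of_odd s hn
  have h₁ : r < (-(s + 1 + (n / 3 - i) : ℕ) : ℤ) := hmono.lt_iff_lt.mp (by omega)
  have h₂ : (-(s + 1 + (n / 3 - i + 1) : ℕ) : ℤ) < r := hmono.lt_iff_lt.mp (by omega)
  omega

lemma checkFrom_spec {n f s : ℕ} (h : checkFrom n f s ((n + s).choose s) = true) {t : ℕ}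
    (hst : s ≤ t) (ht : t < s + f) (h9 : 9 ≤ t) :
    ¬ n ∣ (n + t).choose t ^ 7 ∨ signChange n t = true := by
  induction f generalizing s with
  | zero => omega
  | succ f ih =>
    rw [checkFrom, Bool.and_eq_true] at h
    rcases hst.eq_or_lt with rfl | hlt
    · have h' := h.1
      simp only [Bool.or_eq_true, Nat.blt_eq, Bool.not_eq_true', beq_eq_false_iff_ne] at h'
      rcases h' with (h' | h') | h'
      · omega
      · left
        rwa [Nat.dvd_iff_mod_eq_zero, Nat.pow_mod]
      · exact Or.inr h'
    · refine ih ?_ hlt (by omega)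
      have hc : (n + s).choose s * (n + s + 1) / (s + 1) = (n + (s + 1)).choose (s + 1) := by
        refine Nat.div_eq_of_eq_mul_left (Nat.succ_pos s) ?_
        rw [mul_comm, Nat.add_one_mul_choose_eq]
        rfl
      rw [← hc]
      exact h.2

set_option maxRecDepth 10000 in
lemma checkFrom_odd :
    ((List.range 63).all fun i => checkFrom (2 * i + 3) 104 0 1) = true := by
  decide +kernel

lemma eval_g1Int_ne_zero {n s : ℕ} (hn3 : 3 ≤ n) (hn : n ≤ 127) (hs9 : 9 ≤ s) (hs : s ≤ 103)
    (r : ℤ) : (g1Int s n).eval r ≠ 0 := by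
  rcases Nat.even_or_odd n with he | ho
  · exact eval_g1Int_ne_zero_of_even s he r
  · have hcheck : checkFrom n 104 0 ((n + 0).choose 0) = true := by
      obtain ⟨i, rfl⟩ := ho
      have h := List.all_eq_true.mp checkFrom_odd (i - 1) (List.mem_range.mpr (by omega))
      rwa [show 2 * (i - 1) + 3 = 2 * i + 1 by omega] at h
    rcases checkFrom_spec hcheck (Nat.zero_le s) (by omega) hs9 with h | h
    · intro hr
      refine h (dvd_pow_of_forall_prime_dvd (by omega) (by omega) fun p hp hpn => ?_)
      exact prime_dvd_choose_of_eval_g1Int_eq_zero hp hpn hr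
    · exact eval_g1Int_ne_zero_of_signChange ho h r

theorem g1_irreducible_small_n_s (n s : ℕ) (hn3 : 3 ≤ n) (hn : n ≤ 127)
    (hs9 : 9 ≤ s) (hs : s ≤ 103)
    (hfac : ∃ l q : ℚ[X], l.natDegree = 1 ∧ Irreducible q ∧ g1 n s = l * q) :
    Irreducible (g1 n s) := by
  exfalso
  obtain ⟨l, q, hl, -, hg⟩ := hfac
  obtain ⟨x, hx⟩ := exists_root_of_degree_eq_one
    ((degree_eq_iff_natDegree_eq_of_pos one_pos).mpr hl)
  have hroot : aeval x (g1Int s n) = 0 := by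
    rw [aeval_def, eval₂_eq_eval_map, algebraMap_int_eq, map_g1Int, hg, eval_mul, hx.eq_zero,
      zero_mul]
  obtain ⟨r, rfl, -⟩ := exists_integer_of_is_root_of_monic (monic_g1Int s n) hroot
  rw [aeval_algebraMap_apply, map_eq_zero_iff _ (algebraMap ℤ ℚ).injective_int] at hroot
  exact eval_g1Int_ne_zero hn3 hn hs9 hs r (by simpa using hroot)
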